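/- arXiv:2507.03672 — 2 statements merged into one kernel-verified Lean document; each statement's English description precedes it below -/
import Mathlib

section
/- Let T be a bounded linear operator on a complex Hilbert space H, let k, n be natural numbers and λ > 0, and suppose T^{*k}(λ² T^*T − T^n T^{*n})T^k ≥ 0. Let M denote the closure of the range of T^k, which is a closed T-invariant subspace, and let A = T|_M be the restriction of T to M. Then λ² A^*A − A^n A^{*n} ≥ 0 on M; i.e., A is an n-power posinormal operator on M. -/
open ContinuousLinearMap
open scoped ComplexInnerProductSpace ComplexOrder

theorem aux_mul {E : Type*} [NormedAddCommGroup E] [InnerProductSpace ℂ E]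
    (S R : E →L[ℂ] E) (x : E) : (S * R) x = S (R x) := rfl

theorem aux_inner {E : Type*} [NormedAddCommGroup E] [InnerProductSpace ℂ E] [CompleteSpace E]
    (S : E →L[ℂ] E) (n : ℕ) (l : ℝ) (x : E) :
    ⟪(((l : ℂ) ^ 2) • (adjoint S * S) - S ^ n * (adjoint S) ^ n) x, x⟫ =
      ((l ^ 2 * ‖S x‖ ^ 2 - ‖((adjoint S) ^ n) x‖ ^ 2 : ℝ) : ℂ) := by
  have h1 : adjoint (S ^ n) = (adjoint S) ^ n := by
    simp only [← ContinuousLinearMap.star_eq_adjoint, star_pow]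
  have h2 : ⟪(S ^ n) (((adjoint S) ^ n) x), x⟫ = ((‖((adjoint S) ^ n) x‖ ^ 2 : ℝ) : ℂ) := by
    rw [← ContinuousLinearMap.adjoint_inner_right, h1, inner_self_eq_norm_sq_to_K]
    simp
  have h3 : ⟪(adjoint S) (S x), x⟫ = ((‖S x‖ ^ 2 : ℝ) : ℂ) := by
    rw [ContinuousLinearMap.adjoint_inner_left, inner_self_eq_norm_sq_to_K]
    simp
  simp only [sub_apply, smul_apply,
    aux_mul, inner_sub_left, inner_smul_left, h2, h3]
  simp only [map_pow, Complex.conj_ofReal]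
  push_cast
  rfl

/-- Suppose `T^{*k}(λ² T^*T − Tⁿ T^{*n})T^k ≥ 0`. Let `M` be the closure of the
range of `T^k` (a closed `T`-invariant subspace) and let `A = T|_M`. Then
`λ² A^*A − Aⁿ A^{*n} ≥ 0` on `M`, i.e. `A` is `n`-power posinormal. -/
theorem stmt_8 {H : Type*} [NormedAddCommGroup H] [InnerProductSpace ℂ H] [CompleteSpace H]
    (T : H →L[ℂ] H) (k n : ℕ) (l : ℝ) (hl : 0 < l)
    (hT : ∀ x : H,
      (0 : ℂ) ≤
        ⟪((adjoint T) ^ k * (((l : ℂ) ^ 2) • (adjoint T * T) - T ^ n * (adjoint T) ^ n) * T ^ k)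
            x, x⟫)
    (M : Submodule ℂ H) (hM : M = (LinearMap.range ((T ^ k : H →L[ℂ] H) : H →ₗ[ℂ] H)).topologicalClosure)
    [CompleteSpace M]
    (hMi : ∀ x ∈ M, T x ∈ M)
    (A : M →L[ℂ] M) (hA : ∀ x : M, (A x : H) = T x) :
    ∀ x : M,
      (0 : ℂ) ≤ ⟪(((l : ℂ) ^ 2) • (adjoint A * A) - A ^ n * (adjoint A) ^ n) x, x⟫ := by
  have adj : ∀ m : ℕ, adjoint (T ^ m) = (adjoint T) ^ m := fun m => by
    simp only [← ContinuousLinearMap.star_eq_adjoint, star_pow]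
  have adjA : ∀ m : ℕ, adjoint (A ^ m) = (adjoint A) ^ m := fun m => by
    simp only [← ContinuousLinearMap.star_eq_adjoint, star_pow]
  have hpow : ∀ (m : ℕ) (x : M), (((A ^ m) x : M) : H) = (T ^ m) x := by
    intro m
    induction m with
    | zero => intro x; simp
    | succ m ih =>
      intro x
      rw [pow_succ, pow_succ, aux_mul, aux_mul,
        ih, hA]
  have hcl : ∀ y ∈ M, 0 ≤ l ^ 2 * ‖T y‖ ^ 2 - ‖((adjoint T) ^ n) y‖ ^ 2 := by
    intro y hy
    rw [hM, ← SetLike.mem_coe, Submodule.topologicalClosure_coe] at hy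
    have hc : IsClosed {y : H | 0 ≤ l ^ 2 * ‖T y‖ ^ 2 - ‖((adjoint T) ^ n) y‖ ^ 2} :=
      isClosed_le continuous_const (by fun_prop)
    refine closure_minimal ?_ hc hy
    rintro _ ⟨z, rfl⟩
    have h := hT z
    rw [aux_mul, aux_mul, ← adj k,
      ContinuousLinearMap.adjoint_inner_left, aux_inner] at h
    exact_mod_cast h
  intro x
  rw [aux_inner]
  have h0 := hcl x x.2
  have hAx : ‖A x‖ = ‖T x‖ := by rw [← hA, Submodule.coe_norm]
  have hle : ‖((adjoint A) ^ n) x‖ ≤ ‖((adjoint T) ^ n) (x : H)‖ := by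
    set w := ((adjoint A) ^ n) x with hw
    have e : ⟪w, w⟫ = ⟪(w : H), ((adjoint T) ^ n) (x : H)⟫ := by
      rw [← adj n, ContinuousLinearMap.adjoint_inner_right, ← hpow, ← Submodule.coe_inner,
        ← ContinuousLinearMap.adjoint_inner_right (A ^ n) w x, adjA]
    have h1 : ‖w‖ * ‖w‖ ≤ ‖w‖ * ‖((adjoint T) ^ n) (x : H)‖ := by
      calc ‖w‖ * ‖w‖ = ‖⟪w, w⟫‖ := by
            rw [inner_self_eq_norm_sq_to_K]; simp [sq]
        _ ≤ _ := by
            rw [e]; exact norm_inner_le_norm _ _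
    by_contra hlt
    push Not at hlt
    have : 0 < ‖w‖ := lt_of_le_of_lt (norm_nonneg _) hlt
    nlinarith
  have hsq : ‖((adjoint A) ^ n) x‖ ^ 2 ≤ ‖((adjoint T) ^ n) (x : H)‖ ^ 2 := by gcongr
  have : 0 ≤ l ^ 2 * ‖A x‖ ^ 2 - ‖((adjoint A) ^ n) x‖ ^ 2 := by rw [hAx]; linarith
  exact_mod_cast this
end

section
/- Let T be a bounded linear operator on a complex Hilbert space H that is k-quasi n-power posinormal, and suppose the range of T^k is not dense in H. Let M be the closure of the range of T^k and A = T|_M the restriction of T to the invariant subspace M. Then the spectrum of T satisfies σ(T) = σ(A) ∪ {0}. -/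
open ContinuousLinearMap
open scoped ComplexInnerProductSpace ComplexOrder

/-- Let `T` be `k`-quasi `n`-power posinormal and suppose the range of `T^k`
is not dense in `H`. Let `M` be the closure of the range of `T^k` and `A = T|_M` the restriction
of `T` to the invariant subspace `M`. Then `σ(T) = σ(A) ∪ {0}`. -/
theorem stmt_10 {H : Type*} [NormedAddCommGroup H] [InnerProductSpace ℂ H] [CompleteSpace H]
    (T : H →L[ℂ] H) (k n : ℕ)
    (hT : ∃ l : ℝ, 0 < l ∧ ∀ x : H,
      (0 : ℂ) ≤
        ⟪((adjoint T) ^ k * (((l : ℂ) ^ 2) • (adjoint T * T) - T ^ n * (adjoint T) ^ n) * T ^ k)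
            x, x⟫)
    (M : Submodule ℂ H) (hM : M = (LinearMap.range (T ^ k).toLinearMap).topologicalClosure)
    (hMne : M ≠ ⊤) [CompleteSpace M]
    (hMi : ∀ x ∈ M, T x ∈ M)
    (A : M →L[ℂ] M) (hA : ∀ x : M, (A x : H) = T x) :
    spectrum ℂ T = spectrum ℂ A ∪ {0} := by
  have hTk : ∀ x, (T ^ k) x ∈ M := by
    intro x
    rw [hM]
    exact Submodule.le_topologicalClosure _ ⟨x, rfl⟩
  have h0 : (0 : ℂ) ∈ spectrum ℂ T := by
    rw [spectrum.zero_mem_iff]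
    intro hu
    have hb := ContinuousLinearMap.isUnit_iff_bijective.1 (hu.pow k)
    apply hMne
    rw [eq_top_iff]
    intro x _
    obtain ⟨y, rfl⟩ := hb.2 x
    exact hTk y
  have key : ∀ z : ℂ, z ≠ 0 →
      (IsUnit (algebraMap ℂ (H →L[ℂ] H) z - T) ↔ IsUnit (algebraMap ℂ (M →L[ℂ] M) z - A)) := by
    intro z hz
    have eT : ∀ x, (algebraMap ℂ (H →L[ℂ] H) z - T) x = z • x - T x := by
      intro x
      simp [Algebra.algebraMap_eq_smul_one]
    have eA : ∀ x : M, (((algebraMap ℂ (M →L[ℂ] M) z - A) x : M) : H) = z • (x : H) - T x := by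
      intro x
      simp [Algebra.algebraMap_eq_smul_one, hA]
    have mem : ∀ x, z • x - T x ∈ M → x ∈ M := by
      intro x hx
      have h : ∀ j : ℕ, z ^ j • x - (T ^ j) x ∈ M := by
        intro j
        induction j with
        | zero => simp
        | succ j ih =>
          have h1 := M.add_mem (hMi _ ih) (M.smul_mem (z ^ j) hx)
          have h2 : z ^ (j + 1) • x - (T ^ (j + 1)) x
              = T (z ^ j • x - (T ^ j) x) + z ^ j • (z • x - T x) := by
            rw [pow_succ' T, ContinuousLinearMap.mul_apply, map_sub, map_smul, smul_sub,
              smul_smul, pow_succ]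
            abel
          rw [h2]
          exact h1
      have h3 := M.add_mem (h k) (hTk x)
      rw [sub_add_cancel] at h3
      exact (M.smul_mem_iff (pow_ne_zero k hz)).1 h3
    rw [ContinuousLinearMap.isUnit_iff_bijective, ContinuousLinearMap.isUnit_iff_bijective]
    constructor
    · rintro ⟨hi, hs⟩
      constructor
      · intro x y hxy
        apply Subtype.ext
        apply hi
        rw [eT, eT, ← eA, ← eA, hxy]
      · intro m
        obtain ⟨x, hx⟩ := hs m
        rw [eT] at hx
        have hxM : x ∈ M := mem x (by rw [hx]; exact m.2)
        refine ⟨⟨x, hxM⟩, Subtype.ext ?_⟩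
        rw [eA]
        exact hx
    · rintro ⟨hi, hs⟩
      constructor
      · rw [injective_iff_map_eq_zero]
        intro x hx
        rw [eT] at hx
        have hxM : x ∈ M := mem x (by rw [hx]; exact M.zero_mem)
        have h1 : (algebraMap ℂ (M →L[ℂ] M) z - A) ⟨x, hxM⟩ = 0 := by
          apply Subtype.ext
          rw [eA]
          exact hx
        have h2 := (injective_iff_map_eq_zero _).1 hi _ h1
        exact congrArg Subtype.val h2
      · intro y
        have step : ∀ j : ℕ, ∀ w, (∃ v, z • v - T v = (T ^ j) w) → ∃ v, z • v - T v = w := by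
          intro j
          induction j with
          | zero => intro w h; simpa using h
          | succ j ih =>
            rintro w ⟨v, hv⟩
            apply ih
            refine ⟨z⁻¹ • (v + (T ^ j) w), ?_⟩
            rw [pow_succ' T, ContinuousLinearMap.mul_apply] at hv
            rw [map_smul, map_add, ← hv, smul_smul, mul_inv_cancel₀ hz, one_smul,
              add_sub_cancel, smul_smul, inv_mul_cancel₀ hz, one_smul, add_sub_cancel_left]
        obtain ⟨m, hm⟩ := hs ⟨(T ^ k) y, hTk y⟩
        obtain ⟨v, hv⟩ := step k y ⟨m, by rw [← eA, hm]⟩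
        exact ⟨v, by rw [eT, hv]⟩
  ext z
  by_cases hz : z = 0
  · subst hz
    simp [h0]
  · simp only [Set.mem_union, Set.mem_singleton_iff, hz, or_false, spectrum.mem_iff, key z hz]
end
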